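/- M(k,n) equals the maximum length N of a monotone weakly separated path (A_0, A_1, ..., A_N) of k-element subsets of [n] starting at A_0 = {1,...,k} and ending at A_N = {n-k+1,...,n}. -/

import Mathlib

/-- The simple transposition `s_i = (i, i+1)` (1-indexed values) in `S_n`,
realized on `Fin n` (0-indexed positions `i-1` and `i`); junk value `1` otherwise. -/
def sgen (n i : ℕ) : Equiv.Perm (Fin n) :=
  if h : 0 < i ∧ i < n then Equiv.swap ⟨i - 1, by omega⟩ ⟨i, h.2⟩ else 1

/-- `l` is a reduced word for `w ∈ S_n`: its product is `w` and it has minimal length. -/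
def IsReducedWordFor (n : ℕ) (l : List ℕ) (w : Equiv.Perm (Fin n)) : Prop :=
  (l.map (sgen n)).prod = w ∧
    ∀ l' : List ℕ, (l'.map (sgen n)).prod = w → l.length ≤ l'.length

/-- The longest permutation `w_0 = n (n-1) ⋯ 2 1` of `S_n`. -/
def longestPerm (n : ℕ) : Equiv.Perm (Fin n) := Fin.revPerm

/-- `M(k,n)`: the maximum multiplicity of `s_k` among reduced words of `w_0 ∈ S_n`. -/
noncomputable def Mmax (k n : ℕ) : ℕ :=
  sSup {N | ∃ l : List ℕ, IsReducedWordFor n l (longestPerm n) ∧ l.count k = N}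

/-- Two finite sets are weakly separated. -/
def WeaklySeparated (I J : Finset ℕ) : Prop :=
  (∀ a ∈ I \ J, ∀ b ∈ J \ I, a < b) ∨ (∀ b ∈ J \ I, ∀ a ∈ I \ J, b < a)

/-- A monotone weakly separated path: pairwise weakly separated, and each step removes
one element `y` and adds one element `x > y`. -/
def IsMWSPath (P : List (Finset ℕ)) : Prop :=
  (∀ A ∈ P, ∀ B ∈ P, WeaklySeparated A B) ∧
    List.Chain' (fun A B => ∃ x y, y ∈ A ∧ x ∉ A ∧ y < x ∧ B = insert x (A.erase y)) P

open Finset in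
/-- The inversions of `w`, recorded as pairs of values `a < b` with `b` placed before `a`. -/
def inversions {n : ℕ} (w : Equiv.Perm (Fin n)) : Finset (Fin n × Fin n) :=
  univ.filter fun x => x.1 < x.2 ∧ w⁻¹ x.2 < w⁻¹ x.1

/-- The set of the first `k` values of `w`, written with values in `{1, …, n}`. -/
def firstValues {n : ℕ} (k : ℕ) (w : Equiv.Perm (Fin n)) : Finset ℕ :=
  (Finset.univ.filter fun p : Fin n => p.val < k).image fun p => (w p).val + 1

/-- Strong separation with a prescribed direction: `A` lies to the left of `B`. -/
def LeftOf (A B : Finset ℕ) : Prop :=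
  ∀ a ∈ A \ B, ∀ b ∈ B \ A, a < b

section Inversions

variable {n : ℕ}

lemma perm_inv_apply_apply (w : Equiv.Perm (Fin n)) (x : Fin n) : w⁻¹ (w x) = x :=
  w.symm_apply_apply x

lemma mem_inversions {w : Equiv.Perm (Fin n)} {a b : Fin n} :
    (a, b) ∈ inversions w ↔ a < b ∧ w⁻¹ b < w⁻¹ a := by
  simp [inversions]

lemma sgen_of_lt {i : ℕ} (h : 0 < i ∧ i < n) :
    sgen n i = Equiv.swap ⟨i - 1, by omega⟩ ⟨i, h.2⟩ := by
  simp [sgen, h]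

lemma sgen_of_not {i : ℕ} (h : ¬(0 < i ∧ i < n)) : sgen n i = 1 := by
  simp only [sgen, dif_neg h]

lemma sgen_mul_self (i : ℕ) : sgen n i * sgen n i = 1 := by
  by_cases h : 0 < i ∧ i < n
  · rw [sgen_of_lt h, Equiv.swap_mul_self]
  · rw [sgen_of_not h, one_mul]

lemma sgen_inv (i : ℕ) : (sgen n i)⁻¹ = sgen n i :=
  inv_eq_of_mul_eq_one_left (sgen_mul_self i)

lemma sgen_lt_sgen_iff {i : ℕ} (h : 0 < i ∧ i < n) (x y : Fin n) :
    sgen n i x < sgen n i y ↔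
      (x < y ∧ ¬(x.val = i - 1 ∧ y.val = i)) ∨ (x.val = i ∧ y.val = i - 1) := by
  rw [sgen_of_lt h, Equiv.swap_apply_def, Equiv.swap_apply_def]
  simp only [Fin.ext_iff, Fin.lt_def]
  split_ifs <;> simp <;> omega

lemma inversions_mul_sgen {i : ℕ} (h : 0 < i ∧ i < n) (u : Equiv.Perm (Fin n))
    (hu : u ⟨i - 1, by omega⟩ < u ⟨i, h.2⟩) :
    inversions (u * sgen n i) =
      insert (u ⟨i - 1, by omega⟩, u ⟨i, h.2⟩) (inversions u) := by
  ext ⟨a, b⟩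
  obtain ⟨x, rfl⟩ := u.surjective a
  obtain ⟨y, rfl⟩ := u.surjective b
  simp only [Finset.mem_insert, mem_inversions, mul_inv_rev, sgen_inv, Equiv.Perm.mul_apply,
    perm_inv_apply_apply, Prod.mk.injEq, EmbeddingLike.apply_eq_iff_eq,
    sgen_lt_sgen_iff h]
  constructor
  · rintro ⟨h1, ⟨h2, -⟩ | ⟨h2, h3⟩⟩
    · exact Or.inr ⟨h1, h2⟩
    · exact Or.inl ⟨Fin.ext h3, Fin.ext h2⟩
  · rintro (⟨rfl, rfl⟩ | ⟨h1, h2⟩)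
    · exact ⟨hu, Or.inr ⟨rfl, rfl⟩⟩
    · refine ⟨h1, Or.inl ⟨h2, ?_⟩⟩
      rintro ⟨h3, h4⟩
      have hy : y = ⟨i - 1, by omega⟩ := Fin.ext h3
      have hx : x = ⟨i, h.2⟩ := Fin.ext h4
      rw [hx, hy] at h1
      exact lt_asymm h1 hu

lemma card_inversions_mul_sgen {i : ℕ} (h : 0 < i ∧ i < n) (u : Equiv.Perm (Fin n))
    (hu : u ⟨i - 1, by omega⟩ < u ⟨i, h.2⟩) :
    (inversions (u * sgen n i)).card = (inversions u).card + 1 := by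
  rw [inversions_mul_sgen h u hu, Finset.card_insert_of_notMem]
  rw [mem_inversions]
  simp only [perm_inv_apply_apply, not_and, not_lt, Fin.le_def]
  omega

lemma card_inversions_mul_sgen_le (u : Equiv.Perm (Fin n)) (i : ℕ) :
    (inversions (u * sgen n i)).card ≤ (inversions u).card + 1 ∧
      ((inversions (u * sgen n i)).card = (inversions u).card + 1 →
        ∃ h : 0 < i ∧ i < n, u ⟨i - 1, by omega⟩ < u ⟨i, h.2⟩) := by
  by_cases h : 0 < i ∧ i < n
  · rcases lt_trichotomy (u ⟨i - 1, by omega⟩) (u ⟨i, h.2⟩) with hu | hu | hu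
    · exact ⟨(card_inversions_mul_sgen h u hu).le, fun _ => ⟨h, hu⟩⟩
    · have := u.injective hu
      simp only [Fin.mk.injEq] at this
      omega
    · have key := card_inversions_mul_sgen h (u * sgen n i) (by
        simpa [sgen_of_lt h] using hu)
      rw [mul_assoc, sgen_mul_self, mul_one] at key
      exact ⟨by omega, fun h' => by omega⟩
  · rw [sgen_of_not h, mul_one]
    exact ⟨by omega, fun h' => by omega⟩

lemma card_inversions_mul_prod_le (l : List ℕ) (u : Equiv.Perm (Fin n)) :
    (inversions (u * (l.map (sgen n)).prod)).card ≤ (inversions u).card + l.length := by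
  induction l generalizing u with
  | nil => simp
  | cons i l ih =>
    have h1 := ih (u * sgen n i)
    have h2 := (card_inversions_mul_sgen_le u i).1
    simp only [List.map_cons, List.prod_cons, List.length_cons, ← mul_assoc]
    omega

lemma exists_adjacent_lt_of_ne_one (w : Equiv.Perm (Fin n)) (hw : w ≠ 1) :
    ∃ (i : ℕ) (h : 0 < i ∧ i < n), w ⟨i, h.2⟩ < w ⟨i - 1, by omega⟩ := by
  by_contra! hcon
  apply hw
  have hmono : Monotone w := by
    rcases n with _ | n
    · exact fun a => a.elim0
    · rw [Fin.monotone_iff_le_succ]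
      intro i
      have := hcon (i.val + 1) ⟨by omega, by omega⟩
      exact this
  have hid : (w : Fin n → Fin n) = id := by
    have hs : StrictMono w := hmono.strictMono_of_injective w.injective
    funext x
    exact congrArg (fun f : Fin n ≃o Fin n => f x)
      (Subsingleton.elim (hs.orderIsoOfSurjective w w.surjective) (OrderIso.refl _))
  ext x
  simp [hid]

/-- If `inversions u ⊆ inversions v`, then `u` precedes `v` in the right weak order. -/
lemma exists_word_of_inversions_subset (u v : Equiv.Perm (Fin n))
    (h : inversions u ⊆ inversions v) :
    ∃ l : List ℕ, u * (l.map (sgen n)).prod = v ∧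
      l.length + (inversions u).card = (inversions v).card := by
  induction hd : (inversions v).card - (inversions u).card using Nat.strong_induction_on
    generalizing u with
  | _ d ih =>
    by_cases huv : u = v
    · exact ⟨[], by simp [huv]⟩
    obtain ⟨i, hi, hlt⟩ := exists_adjacent_lt_of_ne_one (v⁻¹ * u)
      (fun h1 => huv (inv_mul_eq_one.1 h1).symm)
    simp only [Equiv.Perm.mul_apply] at hlt
    set p : Fin n := ⟨i - 1, by omega⟩ with hp
    set q : Fin n := ⟨i, hi.2⟩ with hq
    have hpq : p < q := by rw [Fin.lt_def]; simp only [hp, hq]; omega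
    have hup : u p < u q := by
      by_contra hcon
      have hne : u q ≠ u p := fun h' => hpq.ne' (u.injective h')
      have hm : (u q, u p) ∈ inversions u :=
        mem_inversions.2 ⟨lt_of_le_of_ne (not_lt.1 hcon) hne, by simpa using hpq⟩
      exact lt_asymm hlt (mem_inversions.1 (h hm)).2
    have hsub : inversions (u * sgen n i) ⊆ inversions v := by
      rw [inversions_mul_sgen hi u hup]
      exact Finset.insert_subset (mem_inversions.2 ⟨hup, hlt⟩) h
    have hcard := card_inversions_mul_sgen hi u hup
    have hle := Finset.card_le_card hsub
    obtain ⟨l, hl, hlen⟩ := ih _ (by omega) (u * sgen n i) hsub rfl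
    refine ⟨i :: l, ?_, ?_⟩
    · simpa [mul_assoc] using hl
    · simp only [List.length_cons]
      omega

lemma inversions_one : inversions (1 : Equiv.Perm (Fin n)) = ∅ := by
  ext ⟨a, b⟩
  rw [mem_inversions]
  simp only [inv_one, Equiv.Perm.coe_one, id_eq, Finset.notMem_empty, iff_false, not_and]
  exact fun h => lt_asymm h

lemma isReducedWordFor_iff {l : List ℕ} {w : Equiv.Perm (Fin n)} :
    IsReducedWordFor n l w ↔
      (l.map (sgen n)).prod = w ∧ l.length = (inversions w).card := by
  have hle : ∀ l' : List ℕ, (l'.map (sgen n)).prod = w →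
      (inversions w).card ≤ l'.length := by
    rintro l' rfl
    simpa [inversions_one] using card_inversions_mul_prod_le l' 1
  refine and_congr_right fun hl => ⟨fun h => ?_, fun h l' hl' => h ▸ hle l' hl'⟩
  obtain ⟨l', hl', hlen⟩ := exists_word_of_inversions_subset 1 w (by simp [inversions_one])
  have h1 := h l' (by simpa using hl')
  have h2 := hle l hl
  simp only [inversions_one, Finset.card_empty] at hlen
  omega

lemma inversions_subset_longestPerm (w : Equiv.Perm (Fin n)) :
    inversions w ⊆ inversions (longestPerm n) := by
  rintro ⟨a, b⟩ h
  rw [mem_inversions] at h ⊢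
  refine ⟨h.1, ?_⟩
  have hinv : (longestPerm n)⁻¹ = Fin.revPerm := by
    rw [longestPerm, Equiv.Perm.inv_def, Fin.revPerm_symm]
  rw [hinv]
  simpa using h.1

end Inversions

section FirstValues

variable {n k : ℕ}

lemma succ_mem_firstValues {w : Equiv.Perm (Fin n)} {a : Fin n} :
    a.val + 1 ∈ firstValues k w ↔ (w⁻¹ a).val < k := by
  simp only [firstValues, Finset.mem_image, Finset.mem_filter, Finset.mem_univ, true_and,
    Nat.add_right_cancel_iff, Fin.val_inj]
  constructor
  · rintro ⟨p, hp, rfl⟩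
    simpa using hp
  · exact fun h => ⟨w⁻¹ a, h, by simp⟩

lemma exists_eq_succ_of_mem_Icc {x : ℕ} (hx : x ∈ Finset.Icc 1 n) :
    ∃ a : Fin n, x = a.val + 1 := by
  rw [Finset.mem_Icc] at hx
  exact ⟨⟨x - 1, by omega⟩, by simp only; omega⟩

lemma firstValues_subset (w : Equiv.Perm (Fin n)) : firstValues k w ⊆ Finset.Icc 1 n := by
  intro x hx
  simp only [firstValues, Finset.mem_image] at hx
  obtain ⟨p, -, rfl⟩ := hx
  rw [Finset.mem_Icc]
  omega

/-- Subsets of `{1, …, n}` agree when they have the same members `a + 1`, for `a : Fin n`. -/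
lemma ext_of_subset_Icc {A B : Finset ℕ} (hA : A ⊆ Finset.Icc 1 n) (hB : B ⊆ Finset.Icc 1 n)
    (h : ∀ a : Fin n, a.val + 1 ∈ A ↔ a.val + 1 ∈ B) : A = B := by
  ext x
  constructor
  · intro hx
    obtain ⟨a, rfl⟩ := exists_eq_succ_of_mem_Icc (hA hx)
    exact (h a).1 hx
  · intro hx
    obtain ⟨a, rfl⟩ := exists_eq_succ_of_mem_Icc (hB hx)
    exact (h a).2 hx

lemma card_firstValues (hk : k ≤ n) (w : Equiv.Perm (Fin n)) : (firstValues k w).card = k := by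
  rw [firstValues, Finset.card_image_of_injective _ fun a b h => by
    simpa [Fin.val_inj] using h]
  rw [Fin.card_filter_val_lt]
  omega

lemma firstValues_one (hk : k ≤ n) :
    firstValues k (1 : Equiv.Perm (Fin n)) = Finset.Icc 1 k := by
  refine ext_of_subset_Icc (firstValues_subset _) (Finset.Icc_subset_Icc_right hk) fun a => ?_
  rw [succ_mem_firstValues, Finset.mem_Icc]
  simp only [inv_one, Equiv.Perm.coe_one, id_eq]
  omega

lemma firstValues_longestPerm (hk : k ≤ n) :
    firstValues k (longestPerm n) = Finset.Icc (n - k + 1) n := by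
  refine ext_of_subset_Icc (firstValues_subset _)
    (Finset.Icc_subset_Icc_left (by omega)) fun a => ?_
  have hinv : (longestPerm n)⁻¹ = Fin.revPerm := by
    rw [longestPerm, Equiv.Perm.inv_def, Fin.revPerm_symm]
  rw [succ_mem_firstValues, Finset.mem_Icc, hinv, Fin.revPerm_apply, Fin.val_rev]
  omega

lemma firstValues_mul_sgen_of_ne {i : ℕ} (hi : i ≠ k) (u : Equiv.Perm (Fin n)) :
    firstValues k (u * sgen n i) = firstValues k u := by
  refine ext_of_subset_Icc (firstValues_subset _) (firstValues_subset _) fun a => ?_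
  rw [succ_mem_firstValues, succ_mem_firstValues, mul_inv_rev, sgen_inv, Equiv.Perm.mul_apply]
  by_cases h : 0 < i ∧ i < n
  · rw [sgen_of_lt h, Equiv.swap_apply_def]
    simp only [Fin.ext_iff]
    split_ifs <;> simp only <;> omega
  · rw [sgen_of_not h, Equiv.Perm.one_apply]

lemma firstValues_mul_sgen_self (h : 0 < k ∧ k < n) (u : Equiv.Perm (Fin n)) :
    firstValues k (u * sgen n k) =
      insert ((u ⟨k, h.2⟩).val + 1)
        ((firstValues k u).erase ((u ⟨k - 1, by omega⟩).val + 1)) := by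
  refine ext_of_subset_Icc (firstValues_subset _) ?_ fun a => ?_
  · refine Finset.insert_subset ?_ ((Finset.erase_subset _ _).trans (firstValues_subset _))
    rw [Finset.mem_Icc]
    omega
  obtain ⟨x, rfl⟩ := u.surjective a
  rw [Finset.mem_insert, Finset.mem_erase, succ_mem_firstValues, succ_mem_firstValues,
    mul_inv_rev, sgen_inv, Equiv.Perm.mul_apply, perm_inv_apply_apply]
  simp only [ne_eq, Nat.add_right_cancel_iff, Fin.val_inj, EmbeddingLike.apply_eq_iff_eq]
  rw [sgen_of_lt h, Equiv.swap_apply_def]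
  simp only [Fin.ext_iff]
  split_ifs <;> (try simp only) <;> omega

lemma firstValues_mul_prod_of_notMem {l : List ℕ} (hl : k ∉ l) (u : Equiv.Perm (Fin n)) :
    firstValues k (u * (l.map (sgen n)).prod) = firstValues k u := by
  induction l generalizing u with
  | nil => simp
  | cons i l ih =>
    simp only [List.mem_cons, not_or] at hl
    rw [List.map_cons, List.prod_cons, ← mul_assoc, ih hl.2,
      firstValues_mul_sgen_of_ne (Ne.symm hl.1)]

lemma leftOf_firstValues {u v : Equiv.Perm (Fin n)} (h : inversions u ⊆ inversions v) :
    LeftOf (firstValues k u) (firstValues k v) := by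
  intro x hx y hy
  rw [Finset.mem_sdiff] at hx hy
  obtain ⟨a, rfl⟩ := exists_eq_succ_of_mem_Icc (firstValues_subset u hx.1)
  obtain ⟨b, rfl⟩ := exists_eq_succ_of_mem_Icc (firstValues_subset v hy.1)
  simp only [succ_mem_firstValues] at hx hy
  by_contra hcon
  have hne : b ≠ a := by rintro rfl; exact hx.2 hy.1
  have hba : b < a := lt_of_le_of_ne (by rw [Fin.le_def]; omega) hne
  have hm := h (mem_inversions.2 ⟨hba, by rw [Fin.lt_def]; omega⟩)
  have := (mem_inversions.1 hm).2
  rw [Fin.lt_def] at this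
  omega

end FirstValues

section WordToPath

variable {n k : ℕ}

/-- The sets of first `k` values along a length-additive word form a path with one step for
each occurrence of `k`. -/
lemma exists_path_of_word (hk : k ≤ n) (l : List ℕ) (u : Equiv.Perm (Fin n))
    (hl : l.length + (inversions u).card = (inversions (u * (l.map (sgen n)).prod)).card) :
    ∃ P : List (Finset ℕ), P.Pairwise LeftOf ∧
      P.IsChain (fun A B => ∃ x y, y ∈ A ∧ x ∉ A ∧ y < x ∧ B = insert x (A.erase y)) ∧
      P.length = l.count k + 1 ∧ P.head? = some (firstValues k u) ∧
      P.getLast? = some (firstValues k (u * (l.map (sgen n)).prod)) ∧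
      ∀ A ∈ P, ∃ v : Equiv.Perm (Fin n), A = firstValues k v ∧ inversions u ⊆ inversions v := by
  induction l generalizing u with
  | nil => exact ⟨[firstValues k u], by simp; exact ⟨u, rfl, subset_rfl⟩⟩
  | cons i l ih =>
    rw [List.map_cons, List.prod_cons, ← mul_assoc, List.length_cons] at hl
    have h1 := card_inversions_mul_prod_le l (u * sgen n i)
    have h2 := card_inversions_mul_sgen_le u i
    obtain ⟨hi, hlt⟩ := h2.2 (by omega)
    have hsub : inversions u ⊆ inversions (u * sgen n i) := by
      rw [inversions_mul_sgen hi u hlt]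
      exact Finset.subset_insert _ _
    obtain ⟨P, hpw, hch, hlen, hhead, hlast, hmem⟩ := ih (u * sgen n i) (by omega)
    rw [List.map_cons, List.prod_cons, ← mul_assoc]
    have hmem' : ∀ A ∈ P, ∃ v : Equiv.Perm (Fin n),
        A = firstValues k v ∧ inversions u ⊆ inversions v := fun A hA => by
      obtain ⟨v, hv, hv'⟩ := hmem A hA
      exact ⟨v, hv, hsub.trans hv'⟩
    by_cases hik : i = k
    · subst hik
      refine ⟨firstValues i u :: P, ?_, ?_, ?_, rfl, ?_, ?_⟩
      · refine List.pairwise_cons.2 ⟨fun A hA => ?_, hpw⟩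
        obtain ⟨v, rfl, hv⟩ := hmem' A hA
        exact leftOf_firstValues hv
      · refine List.isChain_cons.2 ⟨fun B hB => ?_, hch⟩
        rw [hhead, Option.mem_some_iff] at hB
        subst hB
        refine ⟨_, _, ?_, ?_, ?_, firstValues_mul_sgen_self hi u⟩
        · rw [succ_mem_firstValues, perm_inv_apply_apply]
          simp only
          omega
        · rw [succ_mem_firstValues, perm_inv_apply_apply]
          simp
        · rw [Fin.lt_def] at hlt
          omega
      · simp [hlen]
      · rw [List.getLast?_cons, hlast]
        rfl
      · intro A hA
        rcases List.mem_cons.1 hA with rfl | hA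
        · exact ⟨u, rfl, subset_rfl⟩
        · exact hmem' A hA
    · rw [firstValues_mul_sgen_of_ne hik] at hhead
      exact ⟨P, hpw, hch, by rw [hlen, List.count_cons_of_ne hik], hhead, hlast, hmem'⟩

end WordToPath

section PathToWord

variable {n k : ℕ}

lemma exists_perm_lt_iff (f : Fin n → ℕ) (hf : Function.Injective f) :
    ∃ v : Equiv.Perm (Fin n), ∀ x y, v⁻¹ x < v⁻¹ y ↔ f x < f y := by
  refine ⟨Tuple.sort f, fun x y => ?_⟩
  have hs : StrictMono (f ∘ Tuple.sort f) :=
    (Tuple.monotone_sort f).strictMono_of_injective (hf.comp (Tuple.sort f).injective)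
  rw [← hs.lt_iff_lt]
  simp

/-- Moving the elements of `B` to the front of `w`, keeping the order otherwise. -/
lemma exists_perm_move_front (w : Equiv.Perm (Fin n)) (B : Finset ℕ) :
    ∃ v : Equiv.Perm (Fin n), ∀ x y : Fin n, v⁻¹ x < v⁻¹ y ↔
      (x.val + 1 ∈ B ∧ y.val + 1 ∉ B) ∨
        ((x.val + 1 ∈ B ↔ y.val + 1 ∈ B) ∧ w⁻¹ x < w⁻¹ y) := by
  obtain ⟨v, hv⟩ := exists_perm_lt_iff
    (fun x : Fin n => (if x.val + 1 ∈ B then 0 else n) + (w⁻¹ x).val) (fun x y hxy => by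
      have hx := (w⁻¹ x).isLt
      have hy := (w⁻¹ y).isLt
      apply (w⁻¹).injective
      rw [Fin.ext_iff]
      simp only at hxy
      split_ifs at hxy <;> omega)
  refine ⟨v, fun x y => ?_⟩
  rw [hv, Fin.lt_def]
  have hx := (w⁻¹ x).isLt
  have hy := (w⁻¹ y).isLt
  by_cases h1 : x.val + 1 ∈ B <;> by_cases h2 : y.val + 1 ∈ B <;> simp [h1, h2] <;> omega

lemma firstValues_eq_of_front (hk : k ≤ n) {B : Finset ℕ} (hB : B ⊆ Finset.Icc 1 n)
    (hcard : B.card = k) (v : Equiv.Perm (Fin n))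
    (hv : ∀ x y : Fin n, x.val + 1 ∈ B → y.val + 1 ∉ B → v⁻¹ x < v⁻¹ y) :
    firstValues k v = B := by
  refine (Finset.eq_of_subset_of_card_le (fun x hx => ?_)
    (by rw [hcard, card_firstValues hk])).symm
  obtain ⟨b, rfl⟩ := exists_eq_succ_of_mem_Icc (hB hx)
  by_contra hb
  have hsub : insert (b.val + 1) (firstValues k v) ⊆ B := by
    refine Finset.insert_subset hx fun y hy => ?_
    obtain ⟨a, rfl⟩ := exists_eq_succ_of_mem_Icc (firstValues_subset v hy)
    by_contra ha
    have := hv b a hx ha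
    rw [succ_mem_firstValues] at hb hy
    rw [Fin.lt_def] at this
    omega
  have := Finset.card_le_card hsub
  rw [Finset.card_insert_of_notMem hb, card_firstValues hk] at this
  omega

/-- A directed separated sequence of `k`-sets lifts to a chain in the weak order. The set `Q`
collects the sets visited so far; they witness all inversions of the current permutation `w`. -/
lemma exists_word_of_path (hk : k ≤ n) (P : List (Finset ℕ)) (w : Equiv.Perm (Fin n))
    (Q : Set (Finset ℕ))
    (hQ : ∀ a b, (a, b) ∈ inversions w → ∃ C ∈ Q, b.val + 1 ∈ C ∧ a.val + 1 ∉ C)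
    (hQP : ∀ C ∈ Q, ∀ B ∈ P, LeftOf C B) (hP : P.Pairwise LeftOf)
    (hne : (firstValues k w :: P).IsChain (· ≠ ·))
    (hcard : ∀ B ∈ P, B.card = k ∧ B ⊆ Finset.Icc 1 n) :
    ∃ l : List ℕ,
      l.length + (inversions w).card = (inversions (w * (l.map (sgen n)).prod)).card ∧
        P.length ≤ l.count k := by
  induction P generalizing w Q with
  | nil => exact ⟨[], by simp⟩
  | cons B P ih =>
    obtain ⟨v, hv⟩ := exists_perm_move_front w B
    have hB := hcard B List.mem_cons_self
    have hvB : firstValues k v = B :=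
      firstValues_eq_of_front hk hB.2 hB.1 v fun x y hx hy => (hv x y).2 (Or.inl ⟨hx, hy⟩)
    have hsub : inversions w ⊆ inversions v := by
      rintro ⟨a, b⟩ hab
      obtain ⟨C, hC, hbC, haC⟩ := hQ a b hab
      rw [mem_inversions] at hab ⊢
      refine ⟨hab.1, (hv b a).2 ?_⟩
      have hsep : ¬(a.val + 1 ∈ B ∧ b.val + 1 ∉ B) := fun h => by
        have := hQP C hC B List.mem_cons_self _ (Finset.mem_sdiff.2 ⟨hbC, h.2⟩) _
          (Finset.mem_sdiff.2 ⟨h.1, haC⟩)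
        have := hab.1
        rw [Fin.lt_def] at this
        omega
      tauto
    obtain ⟨l₁, hl₁, hlen₁⟩ := exists_word_of_inversions_subset w v hsub
    rw [List.pairwise_cons] at hP
    rw [List.isChain_cons_cons] at hne
    obtain ⟨l₂, hlen₂, hcount₂⟩ := ih v (insert B Q)
      (fun a b hab => by
        rw [mem_inversions, hv] at hab
        rcases hab with ⟨hlt, h | h⟩
        · exact ⟨B, Set.mem_insert _ _, h⟩
        · obtain ⟨C, hC, h'⟩ := hQ a b (mem_inversions.2 ⟨hlt, h.2⟩)
          exact ⟨C, Set.mem_insert_of_mem _ hC, h'⟩)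
      (fun C hC D hD => by
        rcases hC with rfl | hC
        · exact hP.1 D hD
        · exact hQP C hC D (List.mem_cons_of_mem _ hD))
      hP.2 (hvB ▸ hne.2) (fun D hD => hcard D (List.mem_cons_of_mem _ hD))
    have hmem : k ∈ l₁ := by
      by_contra hmem
      apply hne.1
      rw [← hvB, ← hl₁, firstValues_mul_prod_of_notMem hmem]
    have hpos := List.count_pos_iff.2 hmem
    refine ⟨l₁ ++ l₂, ?_, ?_⟩
    · rw [List.map_append, List.prod_append, ← mul_assoc, hl₁, List.length_append]
      omega
    · rw [List.count_append, List.length_cons]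
      omega

lemma leftOf_of_weaklySeparated {A B : Finset ℕ} (h : WeaklySeparated A B)
    (hcard : A.card = B.card) (hsum : ∑ x ∈ A, x < ∑ x ∈ B, x) : LeftOf A B := by
  rcases h with h | h
  · exact h
  intro a ha
  exfalso
  have hne : (A \ B).Nonempty := ⟨a, ha⟩
  have hc : (A \ B).card = (B \ A).card := Finset.card_sdiff_comm hcard
  have h1 : ∑ x ∈ B \ A, x ≤ (B \ A).card • (A \ B).min' hne :=
    Finset.sum_le_card_nsmul _ _ _ fun b hb => (h b hb _ (Finset.min'_mem _ hne)).le
  have h2 : (A \ B).card • (A \ B).min' hne ≤ ∑ x ∈ A \ B, x :=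
    Finset.card_nsmul_le_sum _ _ _ fun b hb => Finset.min'_le _ _ hb
  have h3 := Finset.sum_inter_add_sum_sdiff A B (fun x => x)
  have h4 := Finset.sum_inter_add_sum_sdiff B A (fun x => x)
  rw [Finset.inter_comm] at h4
  rw [hc] at h2
  omega

lemma sum_lt_sum_insert_erase {A : Finset ℕ} {x y : ℕ} (hy : y ∈ A) (hx : x ∉ A) (hxy : y < x) :
    ∑ z ∈ A, z < ∑ z ∈ insert x (A.erase y), z := by
  rw [Finset.sum_insert fun h => hx (Finset.mem_of_mem_erase h), ← Finset.add_sum_erase A _ hy]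
  omega

end PathToWord

theorem stmt13 (n k : ℕ) (hk1 : 1 ≤ k) (hk2 : k ≤ n - 1) :
    Mmax k n =
      sSup {N | ∃ P : List (Finset ℕ), IsMWSPath P ∧ P.length = N + 1 ∧
        P.head? = some (Finset.Icc 1 k) ∧
        P.getLast? = some (Finset.Icc (n - k + 1) n) ∧
        ∀ A ∈ P, A.card = k ∧ A ⊆ Finset.Icc 1 n} := by
  have hk : k ≤ n := by omega
  set S : Set ℕ := {N | ∃ l : List ℕ, IsReducedWordFor n l (longestPerm n) ∧ l.count k = N}
  set T : Set ℕ := {N | ∃ P : List (Finset ℕ), IsMWSPath P ∧ P.length = N + 1 ∧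
        P.head? = some (Finset.Icc 1 k) ∧
        P.getLast? = some (Finset.Icc (n - k + 1) n) ∧
        ∀ A ∈ P, A.card = k ∧ A ⊆ Finset.Icc 1 n}
  change sSup S = sSup T
  have hST : S ⊆ T := by
    rintro N ⟨l, hl, rfl⟩
    rw [isReducedWordFor_iff] at hl
    obtain ⟨P, hpw, hch, hlen, hhead, hlast, hmem⟩ := exists_path_of_word hk l 1
      (by rw [one_mul, hl.1, hl.2, inversions_one, Finset.card_empty, add_zero])
    rw [firstValues_one hk] at hhead
    rw [one_mul, hl.1, firstValues_longestPerm hk] at hlast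
    refine ⟨P, ⟨?_, hch⟩, hlen, hhead, hlast, fun A hA => ?_⟩
    · have hsep : P.Pairwise WeaklySeparated := hpw.imp fun h => Or.inl h
      intro A hA B hB
      rcases eq_or_ne A B with rfl | hAB
      · exact Or.inl (by simp)
      · refine hsep.forall_of_forall_of_flip ?_ ?_ hA hB
        · exact fun _ _ => Or.inl (by simp)
        · exact hpw.imp fun h => Or.inr h
    · obtain ⟨v, rfl, -⟩ := hmem A hA
      exact ⟨card_firstValues hk v, firstValues_subset v⟩
  have hTS : ∀ N ∈ T, ∃ M ∈ S, N ≤ M := by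
    rintro N ⟨P, ⟨hsep, hch⟩, hlen, hhead, -, hcard⟩
    have hsum : P.Pairwise fun A B => ∑ x ∈ A, x < ∑ x ∈ B, x := by
      have : IsTrans (Finset ℕ) fun A B => ∑ x ∈ A, x < ∑ x ∈ B, x :=
        ⟨fun _ _ _ => lt_trans⟩
      refine List.isChain_iff_pairwise.1 (List.IsChain.imp ?_ hch)
      rintro A B ⟨x, y, hy, hx, hxy, rfl⟩
      exact sum_lt_sum_insert_erase hy hx hxy
    have hleft : P.Pairwise LeftOf := hsum.imp_of_mem fun {A B} hA hB h =>
      leftOf_of_weaklySeparated (hsep A hA B hB) ((hcard A hA).1.trans (hcard B hB).1.symm) h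
    have hne : P.IsChain (· ≠ ·) :=
      hsum.isChain.imp fun A B h hAB => by subst hAB; exact lt_irrefl _ h
    obtain ⟨P, rfl⟩ : ∃ P', P = Finset.Icc 1 k :: P' := by
      cases P with
      | nil => simp at hhead
      | cons A P => exact ⟨P, by simpa using hhead⟩
    rw [List.pairwise_cons] at hleft
    obtain ⟨l, hl, hcount⟩ := exists_word_of_path hk P (1 : Equiv.Perm (Fin n)) ∅
      (by simp [inversions_one]) (by simp) hleft.2 (by rwa [firstValues_one hk])
      fun B hB => hcard B (List.mem_cons_of_mem _ hB)
    obtain ⟨l', hl', hlen'⟩ := exists_word_of_inversions_subset _ _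
      (inversions_subset_longestPerm (1 * (l.map (sgen n)).prod))
    refine ⟨_, ⟨l ++ l', isReducedWordFor_iff.2 ⟨?_, ?_⟩, rfl⟩, ?_⟩
    · rw [List.map_append, List.prod_append, ← hl', one_mul]
    · rw [inversions_one, Finset.card_empty] at hl
      rw [List.length_append]
      omega
    · rw [List.count_append]
      rw [List.length_cons] at hlen
      omega
  have hSne : S.Nonempty := by
    obtain ⟨l, hl, hlen⟩ := exists_word_of_inversions_subset _ _
      (inversions_subset_longestPerm (1 : Equiv.Perm (Fin n)))
    exact ⟨_, l, isReducedWordFor_iff.2 ⟨by simpa using hl, by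
      simpa [inversions_one] using hlen⟩, rfl⟩
  have hSbdd : BddAbove S := by
    refine ⟨(inversions (longestPerm n)).card, ?_⟩
    rintro N ⟨l, hl, rfl⟩
    exact List.count_le_length.trans (isReducedWordFor_iff.1 hl).2.le
  have hTle : ∀ N ∈ T, N ≤ sSup S := fun N hN => by
    obtain ⟨M, hM, hNM⟩ := hTS N hN
    exact hNM.trans (le_csSup hSbdd hM)
  exact le_antisymm (csSup_le_csSup ⟨_, hTle⟩ hSne hST) (csSup_le (hSne.mono hST) hTle)
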